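/- Let (X, →) be a transition system with a monotone quasi-ordering ≤, let x ∈ X, and define the sequence of sets D_0 = ↓{x} and D_{k+1} = D_k ∪ ↓Post(D_k) for k ≥ 0. Then the union over all k ∈ ℕ of D_k equals ↓Post*({x}), the downward closure of the set of states reachable from x. -/

import Mathlib

/-- Downward closure of a set under a quasi-ordering. -/
def downcl {X : Type*} (le : X → X → Prop) (A : Set X) : Set X :=
  {x | ∃ a ∈ A, le x a}

/-- Immediate successors of a set of states. -/
def post {X : Type*} (step : X → X → Prop) (A : Set X) : Set X :=
  {y | ∃ x ∈ A, step x y}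

/-- Successors (states reachable in any number of steps) of a set of states. -/
def postStar {X : Type*} (step : X → X → Prop) (A : Set X) : Set X :=
  {y | ∃ x ∈ A, Relation.ReflTransGen step x y}

/-- In a monotone quasi-ordered transition system, the sequence
`D_0 = ↓{x}`, `D_{k+1} = D_k ∪ ↓Post(D_k)` satisfies `⋃_k D_k = ↓Post*({x})`. -/
theorem stmt_5 {X : Type*} (step le : X → X → Prop)
    (hrefl : ∀ x, le x x)
    (htrans : ∀ x y z, le x y → le y z → le x z)
    (hmono : ∀ x y x', step x y → le x x' →
      ∃ y', le y y' ∧ Relation.ReflTransGen step x' y')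
    (x : X) (D : ℕ → Set X)
    (hD0 : D 0 = downcl le {x})
    (hDk : ∀ k, D (k + 1) = D k ∪ downcl le (post step (D k))) :
    (⋃ k, D k) = downcl le (postStar step {x}) := by
  have hdown : ∀ k a z, a ∈ D k → le z a → z ∈ D k := by
    intro k
    induction k with
    | zero =>
      intro a z ha hz
      rw [hD0] at ha ⊢
      obtain ⟨b, hb, hab⟩ := ha
      exact ⟨b, hb, htrans _ _ _ hz hab⟩
    | succ k ih =>
      intro a z ha hz
      rw [hDk] at ha ⊢
      rcases ha with ha | ⟨b, hb, hab⟩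
      · exact Or.inl (ih a z ha hz)
      · exact Or.inr ⟨b, hb, htrans _ _ _ hz hab⟩
  apply Set.Subset.antisymm
  · intro z hz
    obtain ⟨k, hk⟩ := Set.mem_iUnion.mp hz
    clear hz
    induction k generalizing z with
    | zero =>
      rw [hD0] at hk
      obtain ⟨b, hb, hab⟩ := hk
      exact ⟨b, ⟨b, hb, Relation.ReflTransGen.refl⟩, hab⟩
    | succ k ih =>
      rw [hDk] at hk
      rcases hk with hk | ⟨b, ⟨c, hc, hcb⟩, hzb⟩
      · exact ih hk
      · obtain ⟨d, ⟨w, hw, hwd⟩, hcd⟩ := ih hc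
        obtain ⟨y, hby, hdy⟩ := hmono c b d hcb hcd
        exact ⟨y, ⟨w, hw, hwd.trans hdy⟩, htrans _ _ _ hzb hby⟩
  · rintro z ⟨a, ⟨w, hw, hwa⟩, hza⟩
    have key : ∃ k, a ∈ D k := by
      clear hza
      induction hwa with
      | refl => exact ⟨0, by rw [hD0]; exact ⟨w, hw, hrefl w⟩⟩
      | tail _ hbc ih =>
        obtain ⟨k, hk⟩ := ih
        exact ⟨k + 1, by rw [hDk]; exact Or.inr ⟨_, ⟨_, hk, hbc⟩, hrefl _⟩⟩
    obtain ⟨k, hk⟩ := key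
    exact Set.mem_iUnion.mpr ⟨k, hdown k a z hk hza⟩
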